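/- Let n ≥ 2, let F : (Fin n → ℝ) → ℝ be differentiable, and suppose the Bregman divergence D_F satisfies the sufficiency property on Δ_n. Then the induced scoring rule is strictly local: there exists a function g : [0,1] → ℝ such that D_F(δ_i, q) = g(q_i) for every i ∈ Fin n and every q ∈ Δ_n. -/

import Mathlib

/-- The probability simplex on `Fin n`. -/
def simplex (n : ℕ) : Set (Fin n → ℝ) :=
  {p | (∀ i, 0 ≤ p i) ∧ ∑ i, p i = 1}

/-- The point mass at `x : Fin n`. -/
def pointMass {n : ℕ} (x : Fin n) : Fin n → ℝ :=
  fun i => if i = x then 1 else 0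

/-- A (column-)stochastic matrix: nonnegative entries, each column sums to `1`. -/
def IsStochastic {n : ℕ} (Φ : Fin n → Fin n → ℝ) : Prop :=
  (∀ i j, 0 ≤ Φ i j) ∧ ∀ j, ∑ i, Φ i j = 1

/-- The action of a stochastic matrix on a probability vector. -/
def stApply {n : ℕ} (Φ : Fin n → Fin n → ℝ) (p : Fin n → ℝ) : Fin n → ℝ :=
  fun i => ∑ j, Φ i j * p j

/-- A divergence `D` on the simplex satisfies the sufficiency property if
`D (Φp) (Φq) = D p q` for every stochastic matrix `Φ` that can be reversed on
`{p, q}` by some stochastic matrix `Ψ`. -/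
def SufficiencyProperty {n : ℕ} (D : (Fin n → ℝ) → (Fin n → ℝ) → ℝ) : Prop :=
  ∀ p ∈ simplex n, ∀ q ∈ simplex n, ∀ Φ : Fin n → Fin n → ℝ, IsStochastic Φ →
    (∃ Ψ : Fin n → Fin n → ℝ, IsStochastic Ψ ∧
      stApply Ψ (stApply Φ p) = p ∧ stApply Ψ (stApply Φ q) = q) →
    D (stApply Φ p) (stApply Φ q) = D p q

/-- The Bregman divergence of a differentiable function `F`:
`D_F(p,q) = F(p) - F(q) - ⟨∇F(q), p - q⟩`. -/
noncomputable def bregman {n : ℕ} (F : (Fin n → ℝ) → ℝ) (p q : Fin n → ℝ) : ℝ :=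
  F p - F q - fderiv ℝ F q (p - q)

/-- The channel sending the point `i` to `u` and every other point to `v`. -/
def binaryChannel {n : ℕ} (i : Fin n) (u v : Fin n → ℝ) : Fin n → Fin n → ℝ :=
  fun a j => if j = i then u a else v a

theorem isStochastic_binaryChannel {n : ℕ} (i : Fin n) {u v : Fin n → ℝ}
    (hu : u ∈ simplex n) (hv : v ∈ simplex n) : IsStochastic (binaryChannel i u v) := by
  refine ⟨fun a j => ?_, fun j => ?_⟩
  · unfold binaryChannel
    split_ifs
    exacts [hu.1 a, hv.1 a]
  · by_cases h : j = i
    · simpa [binaryChannel, h] using hu.2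
    · simpa [binaryChannel, h] using hv.2

theorem stApply_binaryChannel {n : ℕ} (i : Fin n) (u v : Fin n → ℝ) {p : Fin n → ℝ}
    (hp : ∑ j, p j = 1) :
    stApply (binaryChannel i u v) p = fun a => p i * u a + (1 - p i) * v a := by
  funext a
  have h : ∀ j, binaryChannel i u v a j * p j
      = v a * p j + if j = i then (u a - v a) * p j else 0 := by
    intro j
    unfold binaryChannel
    split_ifs <;> ring
  simp only [stApply, h, Finset.sum_add_distrib, ← Finset.mul_sum, hp, Finset.sum_ite_eq',
    Finset.mem_univ, if_true]
  ring

theorem pointMass_mem_simplex {n : ℕ} (i : Fin n) : pointMass i ∈ simplex n := by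
  refine ⟨fun a => ?_, by simp [pointMass]⟩
  unfold pointMass
  split_ifs <;> norm_num

/-- Every distribution is a mixture of a point mass at `i` and its conditional off `i`. -/
theorem exists_eq_pointMass_mixture {n : ℕ} (i : Fin n) {q : Fin n → ℝ} (hq : q ∈ simplex n) :
    ∃ r ∈ simplex n, (fun a => q i * pointMass i a + (1 - q i) * r a) = q := by
  have hsum : q i + ∑ a ∈ Finset.univ.erase i, q a = 1 := by
    rw [Finset.add_sum_erase _ _ (Finset.mem_univ i), hq.2]
  have hnonneg : ∀ a ∈ Finset.univ.erase i, 0 ≤ q a := fun a _ => hq.1 a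
  by_cases h : q i = 1
  · refine ⟨pointMass i, pointMass_mem_simplex i, funext fun a => ?_⟩
    by_cases ha : a = i
    · simp [pointMass, ha, h]
    · have h0 : ∑ a ∈ Finset.univ.erase i, q a = 0 := by linarith
      have := (Finset.sum_eq_zero_iff_of_nonneg hnonneg).1 h0 a (by simp [ha])
      simp [pointMass, ha, this]
  · have hle : 0 ≤ 1 - q i := by linarith [Finset.sum_nonneg hnonneg]
    have hne : 1 - q i ≠ 0 := fun h' => h (by linarith)
    refine ⟨fun a => (q a - q i * pointMass i a) / (1 - q i), ⟨fun a => ?_, ?_⟩,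
      funext fun a => ?_⟩
    · refine div_nonneg ?_ hle
      by_cases ha : a = i
      · simp [pointMass, ha]
      · simpa [pointMass, ha] using hq.1 a
    · rw [← Finset.sum_div, Finset.sum_sub_distrib, ← Finset.mul_sum, hq.2,
        (pointMass_mem_simplex i).2, mul_one, div_self hne]
    · field_simp
      ring

/-- Under sufficiency, the divergence from a point mass equals its value at a two-point
distribution on arbitrary distinct points `x`, `y`. -/
theorem SufficiencyProperty.apply_pointMass {n : ℕ} {D : (Fin n → ℝ) → (Fin n → ℝ) → ℝ}
    (hD : SufficiencyProperty D) {x y : Fin n} (hxy : x ≠ y) (i : Fin n) {q : Fin n → ℝ}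
    (hq : q ∈ simplex n) :
    D (pointMass i) q
      = D (pointMass x) (fun a => q i * pointMass x a + (1 - q i) * pointMass y a) := by
  obtain ⟨r, hr, hrq⟩ := exists_eq_pointMass_mixture i hq
  have hx := pointMass_mem_simplex x
  have hy := pointMass_mem_simplex y
  have hi := pointMass_mem_simplex i
  have hΦi : stApply (binaryChannel i (pointMass x) (pointMass y)) (pointMass i)
      = pointMass x := by
    rw [stApply_binaryChannel _ _ _ hi.2]
    funext a
    simp [pointMass]
  have hΦq := stApply_binaryChannel i (pointMass x) (pointMass y) hq.2
  have key := hD _ hi q hq _ (isStochastic_binaryChannel i hx hy)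
    ⟨binaryChannel x (pointMass i) r, isStochastic_binaryChannel x hi hr, ?_, ?_⟩
  · rw [← key, hΦi, hΦq]
  · rw [hΦi, stApply_binaryChannel _ _ _ hx.2]
    funext a
    simp [pointMass]
  · rw [hΦq, stApply_binaryChannel]
    · simpa [pointMass, hxy] using hrq
    · rw [Finset.sum_add_distrib, ← Finset.mul_sum, ← Finset.mul_sum, hx.2, hy.2]
      ring

theorem bregman_sufficiency_strictly_local {n : ℕ} (hn : 2 ≤ n)
    (F : (Fin n → ℝ) → ℝ)
    (hdiff : Differentiable ℝ F) (hsuff : SufficiencyProperty (bregman F)) :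
    ∃ g : ℝ → ℝ, ∀ (i : Fin n), ∀ q ∈ simplex n,
      bregman F (pointMass i) q = g (q i) := by
  have hxy : (⟨0, by omega⟩ : Fin n) ≠ ⟨1, by omega⟩ := by simp
  exact ⟨fun t => bregman F (pointMass ⟨0, by omega⟩)
      (fun a => t * pointMass ⟨0, by omega⟩ a + (1 - t) * pointMass ⟨1, by omega⟩ a),
    fun i _ hq => hsuff.apply_pointMass hxy i hq⟩
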